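/- Let G = G_l ⊗ G_r be a true twin composition, and assume D_k(H) ≠ ∅ for each H ∈ {G, G_l, G_r} and each 0 ≤ k ≤ |TS(H)|. If Equation (2) holds for G_l and for G_r, then Equation (2) holds for G. -/

import Mathlib

/-- A finite simple graph on a subset of an ambient vertex type `α`,
together with a designated twin set `TS ⊆ verts`. -/
structure TSGraph (α : Type*) where
  verts : Finset α
  Adj : α → α → Prop
  symm : ∀ u v, Adj u v → Adj v u
  irrefl : ∀ u, ¬ Adj u u
  adj_mem : ∀ u v, Adj u v → u ∈ verts ∧ v ∈ verts
  TS : Finset α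
  TS_sub : TS ⊆ verts

namespace TSGraph

variable {α : Type*} [DecidableEq α]

/-- `f` encodes a perfect matching of the subgraph of `G` induced by `S`:
every vertex of `S` is paired with an adjacent vertex of `S`, involutively. -/
def IsPM (G : TSGraph α) (S : Finset α) (f : α → α) : Prop :=
  ∀ v ∈ S, f v ∈ S ∧ G.Adj v (f v) ∧ f (f v) = v

/-- `S ⊆ V(G)` dominates `V(G) − TS(G)` and, for some `X ⊆ S ∩ TS(G)` of size `k`,
the subgraph induced by `S − X` has a perfect matching. -/
def Adm (G : TSGraph α) (k : ℕ) (S : Finset α) : Prop :=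
  S ⊆ G.verts ∧
  (∀ v ∈ G.verts, v ∉ G.TS → v ∈ S ∨ ∃ u ∈ S, G.Adj u v) ∧
  ∃ X ⊆ S ∩ G.TS, X.card = k ∧ ∃ f, G.IsPM (S \ X) f

/-- Membership in the family `D_k(G)`: admissible of minimum cardinality. -/
def memD (G : TSGraph α) (k : ℕ) (S : Finset α) : Prop :=
  G.Adm k S ∧ ∀ S', G.Adm k S' → S.card ≤ S'.card

/-- `D_k(G) ≠ ∅`. -/
def DkNonempty (G : TSGraph α) (k : ℕ) : Prop := ∃ S, G.memD k S

/-- `D_k(G) ≠ ∅` for all `0 ≤ k ≤ |TS(G)|`. -/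
def AllDkNonempty (G : TSGraph α) : Prop := ∀ k ≤ G.TS.card, G.DkNonempty k

/-- `γ_k(G)`: the common cardinality of the members of `D_k(G)`. -/
noncomputable def gamma (G : TSGraph α) (k : ℕ) : ℕ :=
  sInf {n | ∃ S, G.Adm k S ∧ S.card = n}

/-- A paired-dominating set of `G`. -/
def IsPDS (G : TSGraph α) (D : Finset α) : Prop :=
  D ⊆ G.verts ∧
  (∀ v ∈ G.verts, v ∈ D ∨ ∃ u ∈ D, G.Adj u v) ∧
  ∃ f, G.IsPM D f

/-- `γ_p(G)`: the paired-domination number. -/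
noncomputable def gammaP (G : TSGraph α) : ℕ :=
  sInf {n | ∃ D, G.IsPDS D ∧ D.card = n}

/-- Membership in `D_p(G)`: minimum-cardinality paired-dominating sets. -/
def memDp (G : TSGraph α) (D : Finset α) : Prop :=
  G.IsPDS D ∧ D.card = G.gammaP

/-- `min(G) = min { γ_k(G) : 0 ≤ k ≤ |TS(G)| }`. -/
noncomputable def minVal (G : TSGraph α) : ℕ :=
  sInf {n | ∃ k ≤ G.TS.card, G.gamma k = n}

/-- `α(G)`: the smallest `k` with `γ_k(G) = min(G)`. -/
noncomputable def alphaVal (G : TSGraph α) : ℕ :=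
  sInf {k | k ≤ G.TS.card ∧ G.gamma k = G.minVal}

/-- `β(G)`: the largest `k` with `γ_k(G) = min(G)`. -/
noncomputable def betaVal (G : TSGraph α) : ℕ :=
  sSup {k | k ≤ G.TS.card ∧ G.gamma k = G.minVal}

/-- Membership in `Ψ(G)`: sets in some `D_k(G)` of cardinality `min(G)`. -/
def memPsi (G : TSGraph α) (D : Finset α) : Prop :=
  (∃ k, k ≤ G.TS.card ∧ G.memD k D) ∧ D.card = G.minVal

/-- Equation (2) holds for `G`. -/
def Eq2Holds (G : TSGraph α) : Prop :=
  ∀ k ≤ G.TS.card,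
    (k ≤ G.alphaVal → G.gamma k = G.minVal + G.alphaVal - k) ∧
    (G.betaVal ≤ k → G.gamma k = G.minVal + k - G.betaVal) ∧
    (G.alphaVal < k → k < G.betaVal → Even (k - G.alphaVal) → G.gamma k = G.minVal) ∧
    (G.alphaVal < k → k < G.betaVal → ¬ Even (k - G.alphaVal) → G.gamma k = G.minVal + 1)

/-- `G = Gl ⊗ Gr` (true twin composition). -/
def IsTrueTwin (G Gl Gr : TSGraph α) : Prop :=
  Disjoint Gl.verts Gr.verts ∧
  G.verts = Gl.verts ∪ Gr.verts ∧
  (∀ u v, G.Adj u v ↔ Gl.Adj u v ∨ Gr.Adj u v ∨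
    (u ∈ Gl.TS ∧ v ∈ Gr.TS) ∨ (u ∈ Gr.TS ∧ v ∈ Gl.TS)) ∧
  G.TS = Gl.TS ∪ Gr.TS

/-- `G = Gl ⊙ Gr` (false twin composition). -/
def IsFalseTwin (G Gl Gr : TSGraph α) : Prop :=
  Disjoint Gl.verts Gr.verts ∧
  G.verts = Gl.verts ∪ Gr.verts ∧
  (∀ u v, G.Adj u v ↔ Gl.Adj u v ∨ Gr.Adj u v) ∧
  G.TS = Gl.TS ∪ Gr.TS

/-- `G = Gl ⊕ Gr` (attachment composition). -/
def IsAttach (G Gl Gr : TSGraph α) : Prop :=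
  Disjoint Gl.verts Gr.verts ∧
  G.verts = Gl.verts ∪ Gr.verts ∧
  (∀ u v, G.Adj u v ↔ Gl.Adj u v ∨ Gr.Adj u v ∨
    (u ∈ Gl.TS ∧ v ∈ Gr.TS) ∨ (u ∈ Gr.TS ∧ v ∈ Gl.TS)) ∧
  G.TS = Gl.TS

/-- The twin-set graph `G` arises from a decomposition tree all of whose associated
twin-set graphs satisfy the property `P`. -/
inductive FromDecompTree (P : TSGraph α → Prop) : TSGraph α → Prop where
  | single (G : TSGraph α) (v : α) (hv : G.verts = {v}) (hts : G.TS = {v})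
      (hadj : ∀ u w, ¬ G.Adj u w) (hP : P G) : FromDecompTree P G
  | ttwin (G Gl Gr : TSGraph α) (hl : FromDecompTree P Gl) (hr : FromDecompTree P Gr)
      (h : IsTrueTwin G Gl Gr) (hP : P G) : FromDecompTree P G
  | ftwin (G Gl Gr : TSGraph α) (hl : FromDecompTree P Gl) (hr : FromDecompTree P Gr)
      (h : IsFalseTwin G Gl Gr) (hP : P G) : FromDecompTree P G
  | attach (G Gl Gr : TSGraph α) (hl : FromDecompTree P Gl) (hr : FromDecompTree P Gr)
      (h : IsAttach G Gl Gr) (hP : P G) : FromDecompTree P G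

end TSGraph

/-- The shape described by Equation (2), including the parity of `B - A`. -/
def TwinForm (h : ℕ → ℕ) (n M A B : ℕ) : Prop :=
  A ≤ B ∧ B ≤ n ∧ (B + A) % 2 = 0 ∧ ∀ k ≤ n,
    (k ≤ A → h k + k = M + A) ∧ (B ≤ k → h k + B = M + k) ∧
    (A ≤ k → k ≤ B → h k = M + (k + A) % 2)

theorem TwinForm.lower {h : ℕ → ℕ} {n M A B : ℕ} (H : TwinForm h n M A B) {k : ℕ} (hk : k ≤ n) :
    M + A ≤ h k + k ∧ M + k ≤ h k + B ∧ M ≤ h k ∧ (h k + M + k + A) % 2 = 0 := by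
  obtain ⟨h1, h2, h3, h4⟩ := H
  obtain ⟨a, b, c⟩ := h4 k hk
  rcases le_total k A with h | h
  · have := a h
    omega
  · rcases le_total k B with h' | h'
    · have := c h h'
      omega
    · have := b h'
      omega

theorem TwinForm.near {h : ℕ → ℕ} {n M A B : ℕ} (H : TwinForm h n M A B) {k : ℕ}
    (hA : A ≤ k) (hB : k ≤ B) (hp : (k + A) % 2 = 0) :
    h k = M ∧ (k + 1 ≤ n → h (k + 1) = M + 1) ∧ (1 ≤ k → h (k - 1) = M + 1) := by
  obtain ⟨h1, h2, h3, h4⟩ := H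
  refine ⟨?_, ?_, ?_⟩
  · have := (h4 k (by omega)).2.2 hA hB
    omega
  · intro hn
    obtain ⟨a, b, c⟩ := h4 (k + 1) hn
    rcases Nat.lt_or_ge k B with h | h
    · have := c (by omega) (by omega)
      omega
    · have := b (by omega)
      omega
  · intro hn
    obtain ⟨a, b, c⟩ := h4 (k - 1) (by omega)
    rcases Nat.lt_or_ge A k with h | h
    · have := c (by omega) (by omega)
      omega
    · have := a (by omega)
      omega

/-- The triangle (and parity) condition relating `k` to `p` and `q`. -/
def Tri (p q k : ℕ) : Prop := k ≤ p + q ∧ p ≤ q + k ∧ q ≤ p + k ∧ (p + q + k) % 2 = 0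

/-- The left end of the optimal range of the composition. -/
def newA (al bl ar br : ℕ) : ℕ :=
  if br < al then al - br else if bl < ar then ar - bl else (al + ar) % 2

theorem tri_exists {al bl ar br k : ℕ} (hl : al ≤ bl) (hr : ar ≤ br) (pl : (bl + al) % 2 = 0)
    (pr : (br + ar) % 2 = 0) (h1 : newA al bl ar br ≤ k) (h2 : k ≤ bl + br)
    (h3 : (k + newA al bl ar br) % 2 = 0) :
    ∃ p q, al ≤ p ∧ p ≤ bl ∧ (p + al) % 2 = 0 ∧ ar ≤ q ∧ q ≤ br ∧ (q + ar) % 2 = 0 ∧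
      Tri p q k := by
  unfold newA at h1 h3
  unfold Tri
  split_ifs at h1 h3 with c1 c2
  · rcases le_total k (al + br) with h | h
    · exact ⟨al, br, by omega⟩
    · exact ⟨k - br, br, by omega⟩
  · rcases le_total k (ar + bl) with h | h
    · exact ⟨bl, ar, by omega⟩
    · exact ⟨bl, k - bl, by omega⟩
  · by_cases h : bl + k < br
    · exact ⟨bl, bl + k, by omega⟩
    · rcases le_total k br with h' | h'
      · rcases le_total al (br - k) with h4 | h4
        · exact ⟨br - k, br, by omega⟩
        · exact ⟨al, br, by omega⟩
      · rcases le_total al (k - br) with h4 | h4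
        · exact ⟨k - br, br, by omega⟩
        · exact ⟨al, br, by omega⟩

set_option maxHeartbeats 4000000 in
theorem twinForm_comp {f g h : ℕ → ℕ} {nl nr ml mr al ar bl br : ℕ}
    (F : TwinForm f nl ml al bl) (Gm : TwinForm g nr mr ar br)
    (up : ∀ p q k, p ≤ nl → q ≤ nr → Tri p q k → h k ≤ f p + g q)
    (lo : ∀ k ≤ nl + nr, ∃ p q, p ≤ nl ∧ q ≤ nr ∧ Tri p q k ∧ f p + g q ≤ h k) :
    TwinForm h (nl + nr) (ml + mr) (newA al bl ar br) (bl + br) := by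
  obtain ⟨f1, f2, f3, f4⟩ := id F
  obtain ⟨g1, g2, g3, g4⟩ := id Gm
  have hAB : newA al bl ar br ≤ bl + br := by
    unfold newA
    split_ifs <;> omega
  have hpar : (bl + br + newA al bl ar br) % 2 = 0 := by
    unfold newA
    split_ifs <;> omega
  refine ⟨hAB, by omega, hpar, ?_⟩
  intro k hk
  have low : ml + mr + newA al bl ar br ≤ h k + k ∧ ml + mr + k ≤ h k + (bl + br) ∧
      ml + mr + (k + newA al bl ar br) % 2 ≤ h k := by
    obtain ⟨p, q, hp, hq, ⟨t1, t2, t3, t4⟩, hle⟩ := lo k hk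
    have a := F.lower hp
    have b := Gm.lower hq
    have hA : ml + mr + newA al bl ar br ≤ h k + k := by
      clear hAB hpar up lo
      unfold newA
      split_ifs with c1 c2
      · omega
      · omega
      · rcases Nat.eq_zero_or_pos k with c | c
        · subst c
          have : p = q := by omega
          subst this
          omega
        · omega
    refine ⟨hA, by omega, ?_⟩
    have hQ : (f p + g q + ml + mr + k + newA al bl ar br) % 2 = 0 := by omega
    clear hA
    omega
  refine ⟨?_, ?_, ?_⟩
  · intro hkA
    rcases Nat.eq_or_lt_of_le hkA with e | hlt
    · obtain ⟨p, q, p1, p2, p3, q1, q2, q3, t⟩ :=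
        tri_exists (k := k) f1 g1 f3 g3 (by omega) (by omega) (by omega)
      have := up p q k (by omega) (by omega) t
      have a := (F.near p1 p2 p3).1
      have b := (Gm.near q1 q2 q3).1
      omega
    · by_cases c1 : br < al
      · have e : newA al bl ar br = al - br := by simp [newA, c1]
        have := up (br + k) br k (by omega) (by omega) (by unfold Tri; omega)
        have a := (f4 (br + k) (by omega)).1 (by omega)
        have b := (Gm.near g1 le_rfl g3).1
        omega
      · by_cases c2 : bl < ar
        · have e : newA al bl ar br = ar - bl := by simp [newA, c1, c2]
          have := up bl (bl + k) k (by omega) (by omega) (by unfold Tri; omega)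
          have a := (g4 (bl + k) (by omega)).1 (by omega)
          have b := (F.near f1 le_rfl f3).1
          omega
        · have e : newA al bl ar br = (al + ar) % 2 := by simp [newA, c1, c2]
          have k0 : k = 0 := by omega
          obtain ⟨p, q, p1, p2, p3, q1, q2, q3, t⟩ :=
            tri_exists (k := 1) f1 g1 f3 g3 (by omega) (by omega) (by omega)
          obtain ⟨a, a1, a2⟩ := F.near p1 p2 p3
          obtain ⟨b, b1, b2⟩ := Gm.near q1 q2 q3
          unfold Tri at t
          rcases Nat.lt_or_ge p q with c | c
          · have := up p (q - 1) k (by omega) (by omega) (by unfold Tri; omega)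
            have := b2 (by omega)
            clear a1 a2 b1 b2
            omega
          · have := up (p - 1) q k (by omega) (by omega) (by unfold Tri; omega)
            have := a2 (by omega)
            clear a1 a2 b1 b2
            omega
  · intro hB
    obtain ⟨p, q, hp, hp', hq, hq', e⟩ : ∃ p q, bl ≤ p ∧ p ≤ nl ∧ br ≤ q ∧ q ≤ nr ∧ p + q = k := by
      rcases le_total (k - br) nl with c | c
      · exact ⟨k - br, br, by omega⟩
      · exact ⟨nl, k - nl, by omega⟩
    have := up p q k (by omega) (by omega) (by unfold Tri; omega)
    have a := (f4 p hp').2.1 hp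
    have b := (g4 q hq').2.1 hq
    omega
  · intro hA hB
    by_cases par : (k + newA al bl ar br) % 2 = 0
    · obtain ⟨p, q, p1, p2, p3, q1, q2, q3, t⟩ := tri_exists f1 g1 f3 g3 hA hB par
      have := up p q k (by omega) (by omega) t
      have a := (F.near p1 p2 p3).1
      have b := (Gm.near q1 q2 q3).1
      omega
    · obtain ⟨p, q, p1, p2, p3, q1, q2, q3, t⟩ :=
        tri_exists (k := k - 1) f1 g1 f3 g3 (by omega) (by omega) (by omega)
      obtain ⟨a, a1, a2⟩ := F.near p1 p2 p3
      obtain ⟨b, b1, b2⟩ := Gm.near q1 q2 q3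
      unfold Tri at t
      by_cases c1 : p + 1 ≤ nl
      · have := up (p + 1) q k (by omega) (by omega) (by unfold Tri; omega)
        have := a1 c1
        clear a1 a2 b1 b2
        omega
      · by_cases c2 : q + 1 ≤ nr
        · have := up p (q + 1) k (by omega) (by omega) (by unfold Tri; omega)
          have := b1 c2
          clear a1 a2 b1 b2
          omega
        · by_cases c3 : 1 ≤ p
          · have := up (p - 1) q k (by omega) (by omega) (by unfold Tri; omega)
            have := a2 c3
            clear a1 a2 b1 b2
            omega
          · have := up p (q - 1) k (by omega) (by omega) (by unfold Tri; omega)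
            have := b2 (by omega)
            clear a1 a2 b1 b2
            omega

namespace TSGraph

variable {α : Type*} [DecidableEq α]

theorem IsPM.even {G : TSGraph α} {S : Finset α} {f : α → α} (h : G.IsPM S f) :
    S.card % 2 = 0 := by
  have : ∑ x ∈ S, (1 : ZMod 2) = 0 := by
    refine Finset.sum_involution (fun a _ => f a) ?_ ?_ ?_ ?_
    · intro a ha
      decide
    · intro a ha _ e
      have := (h a ha).2.1
      rw [e] at this
      exact G.irrefl _ this
    · intro a ha
      exact (h a ha).1
    · intro a ha
      exact (h a ha).2.2
  simp only [Finset.sum_const, nsmul_eq_mul, mul_one] at this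
  rw [ZMod.natCast_eq_zero_iff] at this
  omega

theorem Adm.parity {G : TSGraph α} {S : Finset α} {k : ℕ} (h : G.Adm k S) :
    (S.card + k) % 2 = 0 := by
  obtain ⟨_, _, X, hX, rfl, f, hf⟩ := h
  have h1 := hf.even
  have h2 := Finset.card_sdiff_add_card_eq_card (hX.trans Finset.inter_subset_left)
  omega

theorem gamma_le {G : TSGraph α} {S : Finset α} {k : ℕ} (h : G.Adm k S) : G.gamma k ≤ S.card :=
  Nat.sInf_le ⟨S, h, rfl⟩

theorem gamma_spec {G : TSGraph α} (h : G.AllDkNonempty) {k : ℕ} (hk : k ≤ G.TS.card) :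
    ∃ S, G.Adm k S ∧ S.card = G.gamma k := by
  obtain ⟨S, hS, _⟩ := h k hk
  exact Nat.sInf_mem (s := {n | ∃ S, G.Adm k S ∧ S.card = n}) ⟨_, S, hS, rfl⟩

theorem form_of_eq2 {G : TSGraph α} (h : G.AllDkNonempty) (e : G.Eq2Holds) :
    TwinForm G.gamma G.TS.card G.minVal G.alphaVal G.betaVal := by
  have par : ∀ k ≤ G.TS.card, (G.gamma k + k) % 2 = 0 := by
    intro k hk
    obtain ⟨S, hS, e⟩ := gamma_spec h hk
    rw [← e]
    exact hS.parity
  obtain ⟨k0, hk0, hk0'⟩ : ∃ k ≤ G.TS.card, G.gamma k = G.minVal :=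
    Nat.sInf_mem (s := {n | ∃ k ≤ G.TS.card, G.gamma k = n}) ⟨_, 0, Nat.zero_le _, rfl⟩
  have ne : {k | k ≤ G.TS.card ∧ G.gamma k = G.minVal}.Nonempty := ⟨k0, hk0, hk0'⟩
  have bdd : BddAbove {k | k ≤ G.TS.card ∧ G.gamma k = G.minVal} := ⟨_, fun k hk => hk.1⟩
  have ha : G.alphaVal ≤ G.TS.card ∧ G.gamma G.alphaVal = G.minVal := Nat.sInf_mem ne
  have hb : G.betaVal ≤ G.TS.card ∧ G.gamma G.betaVal = G.minVal := Nat.sSup_mem ne bdd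
  have hab : G.alphaVal ≤ G.betaVal := le_csSup bdd ha
  have pa := par _ ha.1
  have pb := par _ hb.1
  rw [ha.2] at pa
  rw [hb.2] at pb
  refine ⟨hab, hb.1, by omega, ?_⟩
  intro k hk
  obtain ⟨e1, e2, e3, e4⟩ := e k hk
  refine ⟨fun h => ?_, fun h => ?_, fun h h' => ?_⟩
  · have := e1 h
    omega
  · have := e2 h
    omega
  · rcases Nat.eq_or_lt_of_le h with c | c
    · have := e1 (by omega)
      omega
    · rcases Nat.eq_or_lt_of_le h' with c' | c'
      · have := e2 (by omega)
        omega
      · by_cases ev : Even (k - G.alphaVal)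
        · have := e3 c c' ev
          rw [Nat.even_iff] at ev
          omega
        · have := e4 c c' ev
          rw [Nat.even_iff] at ev
          omega

theorem eq2_of_form {G : TSGraph α} {M A B : ℕ} (F : TwinForm G.gamma G.TS.card M A B) :
    G.Eq2Holds := by
  obtain ⟨h1, h2, h3, h4⟩ := id F
  have fA := (F.near le_rfl h1 (by omega)).1
  have fB := (F.near h1 le_rfl h3).1
  have eM : G.minVal = M := by
    apply le_antisymm
    · exact Nat.sInf_le ⟨A, by omega, fA⟩
    · refine le_csInf ⟨_, A, by omega, fA⟩ ?_
      rintro n ⟨k, hk, rfl⟩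
      exact (F.lower hk).2.2.1
  have eA : G.alphaVal = A := by
    apply le_antisymm
    · exact Nat.sInf_le ⟨by omega, by omega⟩
    · refine le_csInf ⟨A, by omega, by omega⟩ ?_
      rintro k ⟨hk, e⟩
      have := F.lower hk
      omega
  have eB : G.betaVal = B := by
    apply le_antisymm
    · refine csSup_le ⟨B, by omega, by omega⟩ ?_
      rintro k ⟨hk, e⟩
      have := F.lower hk
      omega
    · exact le_csSup ⟨G.TS.card, fun k hk => hk.1⟩ ⟨by omega, by omega⟩
  intro k hk
  rw [eM, eA, eB]
  obtain ⟨a, b, c⟩ := h4 k hk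
  refine ⟨fun h => ?_, fun h => ?_, fun h h' ev => ?_, fun h h' ev => ?_⟩
  · have := a h
    omega
  · have := b h
    omega
  · have := c h.le h'.le
    rw [Nat.even_iff] at ev
    omega
  · have := c h.le h'.le
    rw [Nat.even_iff] at ev
    omega

theorem IsTrueTwin.symm' {G Gl Gr : TSGraph α} (h : IsTrueTwin G Gl Gr) : IsTrueTwin G Gr Gl := by
  obtain ⟨h1, h2, h3, h4⟩ := h
  refine ⟨h1.symm, by rw [h2, Finset.union_comm], ?_, by rw [h4, Finset.union_comm]⟩
  intro u v
  rw [h3]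
  tauto

/-- Restriction of an admissible set to the left part. -/
theorem restrict_left {G Gl Gr : TSGraph α} (h : IsTrueTwin G Gl Gr) {S X : Finset α} {f : α → α}
    (hS : S ⊆ G.verts) (hd : ∀ v ∈ G.verts, v ∉ G.TS → v ∈ S ∨ ∃ u ∈ S, G.Adj u v)
    (hX : X ⊆ S ∩ G.TS) (hf : G.IsPM (S \ X) f) :
    Gl.Adm ((X ∩ Gl.verts).card + ((S \ X).filter (fun v => v ∈ Gl.verts ∧ f v ∈ Gr.verts)).card)
      (S ∩ Gl.verts) := by
  obtain ⟨h1, h2, h3, h4⟩ := h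
  rw [Finset.disjoint_left] at h1
  have sl := Gl.TS_sub
  have sr := Gr.TS_sub
  have al := Gl.adj_mem
  have ar := Gr.adj_mem
  refine ⟨Finset.inter_subset_right, ?_, ?_⟩
  · intro v hv hvt
    have hvr : v ∉ Gr.TS := fun c => h1 hv (sr c)
    rcases hd v (by simp [h2, hv]) (by simp [h4, hvt, hvr]) with c | ⟨u, hu, hadj⟩
    · left
      simp [c, hv]
    · right
      rw [h3] at hadj
      rcases hadj with c | c | c | c
      · exact ⟨u, by simp [hu, (al _ _ c).1], c⟩
      · exact absurd (ar _ _ c).2 (h1 hv)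
      · exact absurd c.2 hvr
      · exact absurd c.2 hvt
  · refine ⟨(X ∩ Gl.verts) ∪ (S \ X).filter (fun v => v ∈ Gl.verts ∧ f v ∈ Gr.verts), ?_, ?_, f, ?_⟩
    · intro v hv
      simp only [Finset.mem_union, Finset.mem_inter, Finset.mem_filter] at hv ⊢
      rcases hv with ⟨c, d⟩ | ⟨c, d, e⟩
      · have := hX c
        rw [Finset.mem_inter, h4, Finset.mem_union] at this
        refine ⟨⟨this.1, d⟩, this.2.resolve_right fun c => h1 d (sr c)⟩
      · refine ⟨⟨(Finset.mem_sdiff.1 c).1, d⟩, ?_⟩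
        have := (hf v c).2.1
        rw [h3] at this
        rcases this with c | c | c | c
        · exact absurd e (h1 (al _ _ c).2)
        · exact absurd (ar _ _ c).1 (h1 d)
        · exact c.1
        · exact absurd (sr c.1) (h1 d)
    · apply Finset.card_union_of_disjoint
      rw [Finset.disjoint_left]
      intro v hv hv'
      simp only [Finset.mem_inter, Finset.mem_filter, Finset.mem_sdiff] at hv hv'
      exact hv'.1.2 hv.1
    · intro v hv
      simp only [Finset.mem_union, Finset.mem_inter, Finset.mem_filter, Finset.mem_sdiff] at hv
      have hv1 : v ∈ S \ X := by
        rw [Finset.mem_sdiff]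
        tauto
      obtain ⟨m, adj, inv⟩ := hf v hv1
      have hfv : f v ∉ Gr.verts := by
        rw [Finset.mem_sdiff] at hv1
        tauto
      have hfl : f v ∈ Gl.verts := by
        have := hS (Finset.mem_sdiff.1 m).1
        rw [h2, Finset.mem_union] at this
        tauto
      refine ⟨?_, ?_, inv⟩
      · simp only [Finset.mem_union, Finset.mem_inter, Finset.mem_filter, Finset.mem_sdiff, inv]
        rw [Finset.mem_sdiff] at m
        have := h1 hv.1.2
        tauto
      · rw [h3] at adj
        rcases adj with c | c | c | c
        · exact c
        · exact absurd (ar _ _ c).2 hfv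
        · exact absurd (sr c.2) hfv
        · exact absurd (sr c.1) (h1 hv.1.2)

theorem decompose {G Gl Gr : TSGraph α} (h : IsTrueTwin G Gl Gr) {S : Finset α} {k : ℕ}
    (hS : G.Adm k S) : ∃ a b j Sl Sr, a + b = k ∧ Gl.Adm (a + j) Sl ∧ Gr.Adm (b + j) Sr ∧
      Sl.card + Sr.card = S.card := by
  obtain ⟨hSv, hd, X, hX, rfl, f, hf⟩ := hS
  have L := restrict_left h hSv hd hX hf
  have R := restrict_left h.symm' hSv hd hX hf
  obtain ⟨h1, h2, h3, h4⟩ := h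
  have split : ∀ Y : Finset α, Y ⊆ G.verts → (Y ∩ Gl.verts).card + (Y ∩ Gr.verts).card = Y.card := by
    intro Y hY
    rw [← Finset.card_union_of_disjoint, ← Finset.inter_union_distrib_left, ← h2,
      Finset.inter_eq_left.2 hY]
    exact h1.mono Finset.inter_subset_right Finset.inter_subset_right
  have cc : ((S \ X).filter (fun v => v ∈ Gl.verts ∧ f v ∈ Gr.verts)).card =
      ((S \ X).filter (fun v => v ∈ Gr.verts ∧ f v ∈ Gl.verts)).card := by
    refine Finset.card_bij' (fun v _ => f v) (fun v _ => f v) ?_ ?_ ?_ ?_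
    · intro v hv
      rw [Finset.mem_filter] at hv ⊢
      obtain ⟨a, b, c⟩ := hf v hv.1
      exact ⟨a, hv.2.2, by rw [c]; exact hv.2.1⟩
    · intro v hv
      rw [Finset.mem_filter] at hv ⊢
      obtain ⟨a, b, c⟩ := hf v hv.1
      exact ⟨a, hv.2.2, by rw [c]; exact hv.2.1⟩
    · intro v hv
      rw [Finset.mem_filter] at hv
      exact (hf v hv.1).2.2
    · intro v hv
      rw [Finset.mem_filter] at hv
      exact (hf v hv.1).2.2
  rw [← cc] at R
  exact ⟨_, _, _, _, _, split X (fun v hv => hSv (Finset.mem_inter.1 (hX hv)).1), L, R, split S hSv⟩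

theorem Adm.le_card {G : TSGraph α} {S : Finset α} {k : ℕ} (h : G.Adm k S) : k ≤ G.TS.card := by
  obtain ⟨_, _, X, hX, rfl, _⟩ := h
  exact Finset.card_le_card (hX.trans Finset.inter_subset_right)

theorem compose {G Gl Gr : TSGraph α} (h : IsTrueTwin G Gl Gr) {Sl Sr : Finset α} {a b j : ℕ}
    (hl : Gl.Adm (a + j) Sl) (hr : Gr.Adm (b + j) Sr) :
    G.Adm (a + b) (Sl ∪ Sr) ∧ (Sl ∪ Sr).card = Sl.card + Sr.card := by
  obtain ⟨h1, h2, h3, h4⟩ := h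
  obtain ⟨l1, l2, Xl, lX, lc, fl, lf⟩ := hl
  obtain ⟨r1, r2, Xr, rX, rc, fr, rf⟩ := hr
  have sl := Gl.TS_sub
  have sr := Gr.TS_sub
  refine ⟨⟨?_, ?_, ?_⟩, Finset.card_union_of_disjoint (h1.mono l1 r1)⟩
  · rw [h2]
    exact Finset.union_subset_union l1 r1
  · intro v hv hvt
    rw [h2, Finset.mem_union] at hv
    rw [h4, Finset.mem_union] at hvt
    rcases hv with hv | hv
    · rcases l2 v hv (by tauto) with c | ⟨u, hu, c⟩
      · left
        simp [c]
      · exact Or.inr ⟨u, by simp [hu], (h3 _ _).2 (Or.inl c)⟩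
    · rcases r2 v hv (by tauto) with c | ⟨u, hu, c⟩
      · left
        simp [c]
      · exact Or.inr ⟨u, by simp [hu], (h3 _ _).2 (Or.inr (Or.inl c))⟩
  · obtain ⟨Cl, hCl, cl⟩ := Finset.exists_subset_card_eq (s := Xl) (n := j) (by omega)
    obtain ⟨Cr, hCr, cr⟩ := Finset.exists_subset_card_eq (s := Xr) (n := j) (by omega)
    let e : Cl ≃ Cr := Finset.equivOfCardEq (cl.trans cr.symm)
    rw [Finset.disjoint_left] at h1
    have xl : ∀ v ∈ Xl, v ∈ Sl ∧ v ∈ Gl.TS := fun v hv => Finset.mem_inter.1 (lX hv)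
    have xr : ∀ v ∈ Xr, v ∈ Sr ∧ v ∈ Gr.TS := fun v hv => Finset.mem_inter.1 (rX hv)
    refine ⟨(Xl \ Cl) ∪ (Xr \ Cr), ?_, ?_, ?_⟩
    · intro v hv
      simp only [Finset.mem_union, Finset.mem_sdiff, Finset.mem_inter, h4] at hv ⊢
      rcases hv with c | c
      · have := xl v c.1
        tauto
      · have := xr v c.1
        tauto
    · rw [Finset.card_union_of_disjoint]
      · have := Finset.card_sdiff_add_card_eq_card hCl
        have := Finset.card_sdiff_add_card_eq_card hCr
        omega
      · rw [Finset.disjoint_left]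
        intro v hv hv'
        exact h1 (sl (xl v (Finset.mem_sdiff.1 hv).1).2) (sr (xr v (Finset.mem_sdiff.1 hv').1).2)
    · let f : α → α := fun v =>
        if hv : v ∈ Cl then (e ⟨v, hv⟩ : α) else if hv : v ∈ Cr then (e.symm ⟨v, hv⟩ : α)
        else if v ∈ Gl.verts then fl v else fr v
      have dC : ∀ v ∈ Cr, v ∉ Cl := fun v hv hv' =>
        h1 (sl (xl v (hCl hv')).2) (sr (xr v (hCr hv)).2)
      have f1 : ∀ v (hv : v ∈ Cl), f v = (e ⟨v, hv⟩ : α) := fun v hv => by simp [f, hv]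
      have f2 : ∀ v (hv : v ∈ Cr), f v = (e.symm ⟨v, hv⟩ : α) := fun v hv => by
        simp [f, hv, dC v hv]
      have f3 : ∀ v ∈ Sl \ Xl, f v = fl v := fun v hv => by
        rw [Finset.mem_sdiff] at hv
        have a1 : v ∉ Cl := fun c => hv.2 (hCl c)
        have a2 : v ∉ Cr := fun c => h1 (l1 hv.1) (sr (xr v (hCr c)).2)
        simp [f, a1, a2, l1 hv.1]
      have f4 : ∀ v ∈ Sr \ Xr, f v = fr v := fun v hv => by
        rw [Finset.mem_sdiff] at hv
        have a1 : v ∉ Cl := fun c => h1 (sl (xl v (hCl c)).2) (r1 hv.1)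
        have a2 : v ∉ Cr := fun c => hv.2 (hCr c)
        have a3 : v ∉ Gl.verts := fun c => h1 c (r1 hv.1)
        simp [f, a1, a2, a3]
      have mem : ∀ v, v ∈ (Sl ∪ Sr) \ ((Xl \ Cl) ∪ (Xr \ Cr)) ↔
          v ∈ Cl ∨ v ∈ Cr ∨ v ∈ Sl \ Xl ∨ v ∈ Sr \ Xr := by
        intro v
        have b1 : v ∈ Cl → v ∈ Xl := fun c => hCl c
        have b2 : v ∈ Cr → v ∈ Xr := fun c => hCr c
        have b3 : v ∈ Xl → v ∈ Sl := fun c => (xl v c).1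
        have b4 : v ∈ Xr → v ∈ Sr := fun c => (xr v c).1
        have b5 : v ∈ Sl → v ∉ Sr := fun c d => h1 (l1 c) (r1 d)
        simp only [Finset.mem_union, Finset.mem_sdiff]
        tauto
      refine ⟨f, ?_⟩
      intro v hv
      rw [mem, h3]
      rw [mem] at hv
      rcases hv with c | c | c | c
      · have m := (e ⟨v, c⟩).2
        have t1 := (xl v (hCl c)).2
        have t2 := (xr _ (hCr m)).2
        rw [f1 v c, f2 _ m]
        refine ⟨Or.inr (Or.inl m), Or.inr (Or.inr (Or.inl ⟨t1, t2⟩)), by simp⟩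
      · have m := (e.symm ⟨v, c⟩).2
        have t1 := (xr v (hCr c)).2
        have t2 := (xl _ (hCl m)).2
        rw [f2 v c, f1 _ m]
        refine ⟨Or.inl m, Or.inr (Or.inr (Or.inr ⟨t1, t2⟩)), by simp⟩
      · obtain ⟨p, q, r⟩ := lf v c
        rw [f3 v c, f3 _ p]
        exact ⟨Or.inr (Or.inr (Or.inl p)), Or.inl q, r⟩
      · obtain ⟨p, q, r⟩ := rf v c
        rw [f4 v c, f4 _ p]
        exact ⟨Or.inr (Or.inr (Or.inr p)), Or.inr (Or.inl q), r⟩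

end TSGraph

open TSGraph in
/-- For a true twin composition `G = Gl ⊗ Gr` with all `D_k`
families nonempty, if Equation (2) holds for `Gl` and `Gr`, then it holds
for `G`. -/
theorem stmt12 {α : Type*} [DecidableEq α] (G Gl Gr : TSGraph α)
    (hcomp : IsTrueTwin G Gl Gr)
    (hG : G.AllDkNonempty) (hGl : Gl.AllDkNonempty) (hGr : Gr.AllDkNonempty)
    (hl : Gl.Eq2Holds) (hr : Gr.Eq2Holds) :
    G.Eq2Holds := by
  have hc : G.TS.card = Gl.TS.card + Gr.TS.card := by
    rw [hcomp.2.2.2]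
    exact Finset.card_union_of_disjoint (hcomp.1.mono Gl.TS_sub Gr.TS_sub)
  have key := twinForm_comp (h := G.gamma) (form_of_eq2 hGl hl) (form_of_eq2 hGr hr) ?_ ?_
  · rw [← hc] at key
    exact eq2_of_form key
  · intro p q k hp hq t
    obtain ⟨Sl, al, cl⟩ := gamma_spec hGl hp
    obtain ⟨Sr, ar, cr⟩ := gamma_spec hGr hq
    obtain ⟨t1, t2, t3, t4⟩ := t
    obtain ⟨a, b, j, rfl, rfl, rfl⟩ : ∃ a b j, p = a + j ∧ q = b + j ∧ k = a + b :=
      ⟨p - (p + q - k) / 2, q - (p + q - k) / 2, (p + q - k) / 2, by omega⟩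
    obtain ⟨A, B⟩ := compose hcomp al ar
    have := gamma_le A
    omega
  · intro k hk
    obtain ⟨S, hS, c⟩ := gamma_spec hG (k := k) (by omega)
    obtain ⟨a, b, j, Sl, Sr, e, al, ar, c'⟩ := decompose hcomp hS
    have := gamma_le al
    have := gamma_le ar
    exact ⟨a + j, b + j, al.le_card, ar.le_card, by unfold Tri; omega, by omega⟩
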